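/- arXiv:2110.05412 — 2 statements merged into one kernel-verified Lean document; each statement's English description precedes it below -/
import Mathlib

section
/- The relation R on lists is an equivalence relation — reflexive, symmetric, and (nontrivially) transitive — and is a congruence with respect to list concatenation: if R as bs and R cs ds then R (as ++ cs) (bs ++ ds). -/
/-- The commutation deduction system for multiset equality. -/
inductive R {A : Type*} : List A → List A → Prop
  | nil : R [] []
  | cons_cong {a b : A} {as bs : List A} : a = b → R as bs → R (a :: as) (b :: bs)
  | comm {a b : A} {as bs cs : List A} :
      R as (b :: cs) → R (a :: cs) bs → R (a :: as) (b :: bs)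

theorem R.perm {A : Type*} {as bs : List A} (h : R as bs) : as.Perm bs := by
  induction h with
  | nil => exact .nil
  | cons_cong hab _ ih => exact hab ▸ ih.cons _
  | comm _ _ ih₁ ih₂ => exact (ih₁.cons _).trans ((List.Perm.swap _ _ _).trans (ih₂.cons _))

theorem R.of_perm {A : Type*} : ∀ {as bs : List A}, as.Perm bs → R as bs
  | [], _, h => h.nil_eq ▸ .nil
  | a :: as, [], h => absurd h.eq_nil (List.cons_ne_nil a as)
  | a :: as, b :: bs, h => by
    by_cases hab : a = b
    · subst hab
      exact .cons_cong rfl (R.of_perm h.cons_inv)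
    · have hb : b ∈ as :=
        (List.mem_cons.1 (h.mem_iff.2 List.mem_cons_self)).resolve_left (Ne.symm hab)
      obtain ⟨s, t, rfl⟩ := List.append_of_mem hb
      have h₁ : (s ++ b :: t).Perm (b :: (s ++ t)) := List.perm_middle
      have h₂ : (a :: (s ++ t)).Perm bs :=
        (((List.Perm.swap _ _ _).trans (h₁.symm.cons a)).trans h).cons_inv
      exact .comm (R.of_perm h₁) (R.of_perm h₂)
termination_by as => as.length

theorem R_iff_perm {A : Type*} {as bs : List A} : R as bs ↔ as.Perm bs :=
  ⟨R.perm, R.of_perm⟩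

/-- `R` is an equivalence relation and a congruence for list concatenation. -/
theorem R_equivalence_and_append_congruence (A : Type*) :
    (∀ as : List A, R as as) ∧
    (∀ as bs : List A, R as bs → R bs as) ∧
    (∀ as bs cs : List A, R as bs → R bs cs → R as cs) ∧
    (∀ as bs cs ds : List A, R as bs → R cs ds → R (as ++ cs) (bs ++ ds)) := by
  simp only [R_iff_perm]
  exact ⟨List.Perm.refl, fun _ _ h => h.symm, fun _ _ _ h₁ h₂ => h₁.trans h₂,
    fun _ _ _ _ h₁ h₂ => h₁.append h₂⟩
end

section
/- Evaluation and quotation between deduction trees and permutations: for any type A and lists as, bs : List A, R as bs holds if and only if there exists an equivalence φ : Fin as.length ≃ Fin bs.length of index sets such that as.get i = bs.get (φ i) for every index i : Fin as.length. -/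
theorem List.Perm.toR {A : Type*} {as bs : List A} (h : as.Perm bs) : R as bs := by
  induction hn : as.length generalizing as bs with
  | zero =>
    obtain rfl := List.length_eq_zero_iff.1 hn
    exact h.symm.eq_nil ▸ R.nil
  | succ n ih =>
    cases as with
    | nil => simp at hn
    | cons a as =>
      cases bs with
      | nil => exact absurd h.eq_nil (List.cons_ne_nil _ _)
      | cons b bs =>
        have hn' : as.length = n := by simpa using hn
        rcases List.mem_cons.1 (h.mem_iff.2 List.mem_cons_self) with rfl | hb
        · exact .cons_cong rfl (ih h.cons_inv hn')
        · obtain ⟨s, t, rfl⟩ := List.append_of_mem hb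
          have hst : (s ++ b :: t).Perm (b :: (s ++ t)) := List.perm_middle
          have hbs : (a :: (s ++ t)).Perm bs :=
            (((List.Perm.swap a b _).trans (hst.symm.cons a)).trans h).cons_inv
          exact .comm (ih hst hn') (ih hbs (by simpa [Nat.add_assoc] using hn'))

theorem List.ofFn_comp_equiv_perm {A : Type*} {n m : ℕ} (φ : Fin n ≃ Fin m) (f : Fin m → A) :
    (List.ofFn (f ∘ φ)).Perm (List.ofFn f) := by
  obtain rfl : n = m := Fin.equiv_iff_eq.1 ⟨φ⟩
  exact Equiv.Perm.ofFn_comp_perm φ f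

theorem List.Perm.exists_index_equiv {A : Type*} {as bs : List A} (h : as.Perm bs) :
    ∃ φ : Fin as.length ≃ Fin bs.length, ∀ i, as.get i = bs.get (φ i) := by
  induction h with
  | nil => exact ⟨Equiv.refl _, fun _ => rfl⟩
  | cons a _ ih =>
    obtain ⟨φ, hφ⟩ := ih
    refine ⟨(finSuccEquiv _).trans (φ.optionCongr.trans (finSuccEquiv _).symm), ?_⟩
    intro i
    refine Fin.cases ?_ (fun j => ?_) i
    · simp
    · simpa using hφ j
  | swap a b l =>
    refine ⟨Equiv.swap (0 : Fin (l.length + 2)) 1, ?_⟩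
    intro i
    refine Fin.cases ?_ (fun j => Fin.cases ?_ (fun k => ?_) j) i
    · erw [Equiv.swap_apply_left]; rfl
    · erw [Equiv.swap_apply_right]; rfl
    · erw [Equiv.swap_apply_of_ne_of_ne (Fin.succ_ne_zero _)
        (fun h => Fin.succ_ne_zero k (Fin.succ_injective _ h))]
      rfl
  | trans _ _ ih₁ ih₂ =>
    obtain ⟨φ, hφ⟩ := ih₁
    obtain ⟨ψ, hψ⟩ := ih₂
    exact ⟨φ.trans ψ, fun i => (hφ i).trans (hψ _)⟩

theorem List.perm_iff_exists_index_equiv {A : Type*} {as bs : List A} :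
    as.Perm bs ↔ ∃ φ : Fin as.length ≃ Fin bs.length, ∀ i, as.get i = bs.get (φ i) := by
  refine ⟨List.Perm.exists_index_equiv, fun ⟨φ, hφ⟩ => ?_⟩
  rw [← List.ofFn_get as, ← List.ofFn_get bs, funext hφ]
  exact List.ofFn_comp_equiv_perm φ bs.get

/-- Evaluation and quotation: deduction trees in `R` correspond exactly to
permutations of the index sets shuffling one list into the other. -/
theorem R_iff_exists_index_equiv (A : Type*) (as bs : List A) :
    R as bs ↔
      ∃ φ : Fin as.length ≃ Fin bs.length,
        ∀ i : Fin as.length, as.get i = bs.get (φ i) := by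
  rw [R_iff_perm, List.perm_iff_exists_index_equiv]
end
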